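/- (Corollary 3.1, Foster–Lyapunov equation for the Markovian n-server system) Fix m ≥ 1, n ≥ 1, positive constants λᵢⁿ, μᵢⁿ and nonnegative constants γᵢⁿ (i = 1,…,m), and assume ρⁿ := √n·(1 − Σᵢλᵢⁿ/(nμᵢⁿ)) > 0. Then there exist θ ∈ (0,1] and ε̂₀ > 0 such that for every ε ∈ (0, ε̂₀) there is a constant C₀ > 0 for which the function V̂(x) := exp(εθΨⁿ(−x̂ⁿ(x)) + Ψⁿ_ε(x̂ⁿ(x))) satisfies 𝒜ⁿ_z V̂(x) ≤ C₀ − ε·(ρⁿ/(2m))·V̂(x) for all x ∈ ℤ₊^m and all z ∈ 𝒵ⁿ(x). -/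

import Mathlib

open scoped BigOperators

/-- The piecewise function ψ. -/
noncomputable def psiFn (t : ℝ) : ℝ :=
  if t ≤ -1 then -(1/2)
  else if t ≤ 0 then (t+1)^3 - (1/2)*(t+1)^4 - 1/2
  else t

/-- ψ_ε(t) := ψ(εt). -/
noncomputable def psiE (ε t : ℝ) : ℝ := psiFn (ε * t)

/-- Ψ(y) := Σᵢ ψ(yᵢ)/μᵢ. -/
noncomputable def bigPsi {m : ℕ} (μ : Fin m → ℝ) (x : Fin m → ℝ) : ℝ :=
  ∑ i, psiFn (x i) / μ i

/-- Ψ_ε(y) := Σᵢ ψ_ε(yᵢ)/μᵢ. -/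
noncomputable def bigPsiE {m : ℕ} (μ : Fin m → ℝ) (ε : ℝ) (x : Fin m → ℝ) : ℝ :=
  ∑ i, psiE ε (x i) / μ i

/-- ‖x‖₁ = Σᵢ|xᵢ|. -/
noncomputable def norm1 {m : ℕ} (x : Fin m → ℝ) : ℝ := ∑ i, |x i|

/-- The spare-capacity parameter ρⁿ = √n(1 − Σᵢλᵢⁿ/(nμᵢⁿ)). -/
noncomputable def rhoN {m : ℕ} (n : ℕ) (lam μ : Fin m → ℝ) : ℝ :=
  Real.sqrt n * (1 - ∑ i, lam i / (n * μ i))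

/-- The diffusion scaling x̂ⁿ(x)ᵢ = (xᵢ − λᵢⁿ/μᵢⁿ)/√n − ρⁿ/m. -/
noncomputable def hatX {m : ℕ} (n : ℕ) (lam μ : Fin m → ℝ) (x : Fin m → ℕ) :
    Fin m → ℝ :=
  fun i => ((x i : ℝ) - lam i / μ i) / Real.sqrt n - rhoN n lam μ / m

/-- The set of work-conserving allocations 𝒵ⁿ(x). -/
def workCons {m : ℕ} (n : ℕ) (x : Fin m → ℕ) : Set (Fin m → ℕ) :=
  {z | (∀ i, z i ≤ x i) ∧ ∑ i, z i = min n (∑ i, x i)}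

/-- The generator of the n-server system with Poisson arrivals under allocation z. -/
noncomputable def genN {m : ℕ} (lam μ γ : Fin m → ℝ) (z : Fin m → ℕ)
    (f : (Fin m → ℕ) → ℝ) (x : Fin m → ℕ) : ℝ :=
  ∑ i, lam i * (f (x + Pi.single i 1) - f x)
    + ∑ i, (μ i * (z i : ℝ) + γ i * ((x i : ℝ) - (z i : ℝ)))
        * (f (x - Pi.single i 1) - f x)

theorem psiFn_of_le_neg_one {t : ℝ} (h : t ≤ -1) : psiFn t = -(1/2) := if_pos h

theorem psiFn_of_mem {t : ℝ} (h₁ : -1 ≤ t) (h₂ : t ≤ 0) :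
    psiFn t = (t+1)^3 - (1/2)*(t+1)^4 - 1/2 := by
  rcases h₁.eq_or_lt with rfl | h₁
  · norm_num [psiFn]
  · rw [psiFn, if_neg h₁.not_ge, if_pos h₂]

theorem psiFn_of_nonneg {t : ℝ} (h : 0 ≤ t) : psiFn t = t := by
  rcases h.eq_or_lt with rfl | h
  · norm_num [psiFn]
  · rw [psiFn, if_neg (by linarith), if_neg h.not_ge]

/-- A set of increments closed under concatenation that holds on each of the three pieces of `ψ`
holds everywhere. -/
theorem psiFn_induction {P : ℝ → ℝ → Prop} (htrans : ∀ r s t, r ≤ s → s ≤ t → P r s → P s t → P r t)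
    (hleft : ∀ s t, s ≤ t → t ≤ -1 → P s t) (hmid : ∀ s t, -1 ≤ s → s ≤ t → t ≤ 0 → P s t)
    (hright : ∀ s t, 0 ≤ s → s ≤ t → P s t) {s t : ℝ} (hst : s ≤ t) : P s t := by
  have hmr : ∀ s t, -1 ≤ s → s ≤ t → P s t := fun s t hs hst => by
    rcases le_total t 0 with ht | ht
    · exact hmid s t hs hst ht
    rcases le_total s 0 with h0 | h0
    · exact htrans s 0 t h0 ht (hmid s 0 hs h0 le_rfl) (hright 0 t le_rfl ht)
    · exact hright s t h0 hst
  rcases le_total t (-1) with ht | ht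
  · exact hleft s t hst ht
  rcases le_total s (-1) with hs | hs
  · exact htrans s (-1) t hs ht (hleft s (-1) hs le_rfl) (hmr (-1) t le_rfl ht)
  · exact hmr s t hs hst

theorem psiFn_mono {s t : ℝ} (hst : s ≤ t) : psiFn s ≤ psiFn t := by
  refine psiFn_induction (P := fun s t => psiFn s ≤ psiFn t) ?_ ?_ ?_ ?_ hst
  · exact fun r s t _ _ => le_trans
  · intro s t hst ht
    rw [psiFn_of_le_neg_one ht, psiFn_of_le_neg_one (hst.trans ht)]
  · intro s t hs hst ht
    rw [psiFn_of_mem hs (hst.trans ht), psiFn_of_mem (hs.trans hst) ht]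
    obtain ⟨u, rfl⟩ : ∃ u, s = u - 1 := ⟨s + 1, by ring⟩
    obtain ⟨v, rfl⟩ : ∃ v, t = v - 1 := ⟨t + 1, by ring⟩
    have h : 0 ≤ v^2 + u*v + u^2 - (u+v)*(u^2+v^2)/2 := by
      nlinarith [mul_nonneg (by linarith : (0:ℝ) ≤ 2 - u - v) (by positivity : 0 ≤ u^2 + v^2),
        mul_nonneg (by linarith : (0:ℝ) ≤ u) (by linarith : (0:ℝ) ≤ v)]
    linarith [mul_nonneg (by linarith : (0:ℝ) ≤ v - u) h]
  · intro s t hs hst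
    rwa [psiFn_of_nonneg hs, psiFn_of_nonneg (hs.trans hst)]

theorem psiFn_sub_le {s t : ℝ} (hst : s ≤ t) : psiFn t - psiFn s ≤ t - s := by
  refine psiFn_induction (P := fun s t => psiFn t - psiFn s ≤ t - s) ?_ ?_ ?_ ?_ hst
  · intro r s t _ _ h₁ h₂
    linarith
  · intro s t hst ht
    rw [psiFn_of_le_neg_one ht, psiFn_of_le_neg_one (hst.trans ht)]
    linarith
  · intro s t hs hst ht
    rw [psiFn_of_mem hs (hst.trans ht), psiFn_of_mem (hs.trans hst) ht]
    have h : 0 ≤ t^2 + t*s + s^2 + (t+s)*(t^2+s^2)/2 := by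
      nlinarith [mul_nonneg (by linarith : (0:ℝ) ≤ 2 + t + s) (by positivity : 0 ≤ t^2 + s^2),
        mul_nonneg (by linarith : (0:ℝ) ≤ -t) (by linarith : (0:ℝ) ≤ -s)]
    linarith [mul_nonneg (by linarith : (0:ℝ) ≤ t - s) h]
  · intro s t hs hst
    rw [psiFn_of_nonneg hs, psiFn_of_nonneg (hs.trans hst)]

theorem le_psiFn_sub {δ s t : ℝ} (hδ : 0 ≤ δ) (hδ' : δ ≤ 1) (hs : -δ ≤ s) (hst : s ≤ t) :
    (1 - 3 * δ^2) * (t - s) ≤ psiFn t - psiFn s := by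
  refine psiFn_induction
    (P := fun s t => -δ ≤ s → (1 - 3 * δ^2) * (t - s) ≤ psiFn t - psiFn s) ?_ ?_ ?_ ?_ hst hs
  · intro r s t hrs _ h₁ h₂ hr
    linarith [h₁ hr, h₂ (hr.trans hrs)]
  · intro s t hst ht hs
    obtain rfl : s = t := by linarith
    simp
  · intro s t hs hst ht hsδ
    rw [psiFn_of_mem hs (hst.trans ht), psiFn_of_mem (hs.trans hst) ht]
    have h : t^2 + t*s + s^2 + (t+s)*(t^2+s^2)/2 ≤ 3 * δ^2 := by
      have h₁ : t^2 ≤ δ^2 := by nlinarith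
      have h₂ : s^2 ≤ δ^2 := by nlinarith
      have h₃ : t*s ≤ δ^2 := by nlinarith [sq_nonneg (t - s)]
      nlinarith [mul_nonneg (by linarith : (0:ℝ) ≤ - t - s) (by positivity : 0 ≤ t^2 + s^2)]
    linarith [mul_nonneg (by linarith : (0:ℝ) ≤ t - s) (sub_nonneg.2 h)]
  · intro s t hs hst _
    rw [psiFn_of_nonneg hs, psiFn_of_nonneg (hs.trans hst)]
    nlinarith [mul_nonneg (sub_nonneg.2 hst) (sq_nonneg δ)]

/-- The contribution of one coordinate to the exponent of `V̂`, up to the factor `1/μᵢ`. -/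
noncomputable def coordExp (ε θ t : ℝ) : ℝ := ε * θ * psiFn (-t) + psiFn (ε * t)

theorem coordExp_add_sub_le {ε θ a : ℝ} (hε : 0 ≤ ε) (hθ : 0 ≤ θ) (ha : 0 ≤ a) (t : ℝ) :
    coordExp ε θ (t + a) - coordExp ε θ t ≤ ε * a := by
  have h₁ : psiFn (-(t + a)) ≤ psiFn (-t) := psiFn_mono (by linarith)
  have h₂ := psiFn_sub_le (mul_le_mul_of_nonneg_left (by linarith : t ≤ t + a) hε)
  have h₃ := mul_le_mul_of_nonneg_left h₁ (mul_nonneg hε hθ)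
  unfold coordExp
  linarith

theorem le_coordExp_sub {ε θ a L t : ℝ} (hε : 0 ≤ ε) (hθ : 0 ≤ θ) (ha : 0 ≤ a) (hL : 0 ≤ L)
    (hεL : ε * L ≤ 1) (ht : -L ≤ t - a) :
    ε * a * (1 - (3 * (ε * L)^2 + θ)) ≤ coordExp ε θ t - coordExp ε θ (t - a) := by
  have h₁ : psiFn (-(t - a)) - psiFn (-t) ≤ -(t - a) - -t := psiFn_sub_le (by linarith)
  have h₂ := le_psiFn_sub (mul_nonneg hε hL) hεL
    (by linarith [mul_le_mul_of_nonneg_left ht hε] : -(ε * L) ≤ ε * (t - a))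
    (mul_le_mul_of_nonneg_left (by linarith : t - a ≤ t) hε)
  have h₃ := mul_le_mul_of_nonneg_left h₁ (mul_nonneg hε hθ)
  unfold coordExp
  linarith

theorem exponent_eq_sum {m : ℕ} (μ y : Fin m → ℝ) (ε θ : ℝ) :
    ε * θ * bigPsi μ (-y) + bigPsiE μ ε y = ∑ i, coordExp ε θ (y i) / μ i := by
  simp only [bigPsi, bigPsiE, psiE, coordExp, Finset.mul_sum, ← Finset.sum_add_distrib,
    Pi.neg_apply]
  exact Finset.sum_congr rfl fun i _ => by ring

theorem hatX_add_single {m : ℕ} (n : ℕ) (lam μ : Fin m → ℝ) (x : Fin m → ℕ) (i : Fin m) :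
    hatX n lam μ (x + Pi.single i 1)
      = Function.update (hatX n lam μ x) i (hatX n lam μ x i + 1 / Real.sqrt n) := by
  ext j
  rcases eq_or_ne j i with rfl | h
  · simp only [hatX, Function.update_self, Pi.add_apply, Pi.single_eq_same]
    push_cast
    ring
  · simp [hatX, h]

theorem hatX_sub_single {m : ℕ} (n : ℕ) (lam μ : Fin m → ℝ) (x : Fin m → ℕ) (i : Fin m)
    (hx : 1 ≤ x i) :
    hatX n lam μ (x - Pi.single i 1)
      = Function.update (hatX n lam μ x) i (hatX n lam μ x i - 1 / Real.sqrt n) := by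
  ext j
  rcases eq_or_ne j i with rfl | h
  · simp only [hatX, Function.update_self, Pi.sub_apply, Pi.single_eq_same]
    push_cast [hx]
    ring
  · simp [hatX, h]

theorem neg_le_hatX {m : ℕ} (n : ℕ) (hn : 1 ≤ n) (lam μ : Fin m → ℝ) (hlam : ∀ i, 0 < lam i)
    (hμ : ∀ i, 0 < μ i) (hρ : 0 < rhoN n lam μ) (x : Fin m → ℕ) (i : Fin m) :
    -(∑ j, lam j / μ j + rhoN n lam μ) ≤ hatX n lam μ x i := by
  have hs : 1 ≤ Real.sqrt n := Real.one_le_sqrt.2 (by exact_mod_cast hn)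
  have hm : (1:ℝ) ≤ m := by exact_mod_cast i.pos
  have h₁ : lam i / μ i / Real.sqrt n ≤ lam i / μ i :=
    div_le_self (div_pos (hlam i) (hμ i)).le hs
  have h₂ : lam i / μ i ≤ ∑ j, lam j / μ j :=
    Finset.single_le_sum (f := fun j => lam j / μ j)
      (fun j _ => (div_pos (hlam j) (hμ j)).le) (Finset.mem_univ i)
  have h₃ : rhoN n lam μ / m ≤ rhoN n lam μ := div_le_self hρ.le hm
  have h₄ : 0 ≤ (x i : ℝ) / Real.sqrt n := by positivity
  rw [hatX, sub_div]
  linarith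

theorem sum_update_eq {m : ℕ} (f : Fin m → ℝ → ℝ) (y : Fin m → ℝ) (i : Fin m) (v : ℝ) :
    ∑ j, f j (Function.update y i v j) = ∑ j, f j (y j) + (f i v - f i (y i)) := by
  rw [← sub_eq_iff_eq_add', ← Finset.sum_sub_distrib, Finset.sum_eq_single i]
  · simp
  · intro j _ h
    simp [h]
  · simp

theorem exp_sub_one_le {u : ℝ} (hu : |u| ≤ 1) : Real.exp u - 1 ≤ u + u^2 := by
  linarith [(abs_le.1 (Real.abs_exp_sub_one_sub_id_le hu)).2]

theorem sum_rates_sub {m : ℕ} (n : ℕ) (hn : 1 ≤ n) (lam μ : Fin m → ℝ) :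
    1 / Real.sqrt n * (∑ i, lam i / μ i - n) = - rhoN n lam μ := by
  have hn' : (0:ℝ) < n := by exact_mod_cast hn
  have h : ∑ i, lam i / (n * μ i) = (∑ i, lam i / μ i) / n := by
    rw [Finset.sum_div]
    exact Finset.sum_congr rfl fun i _ => by rw [div_div, mul_comm]
  rw [rhoN, h]
  have h1 : Real.sqrt n ≠ 0 := (Real.sqrt_pos.2 hn').ne'
  field_simp
  rw [Real.sq_sqrt hn'.le]
  ring

/-- The multiplicative drift estimate when all `n` servers are busy. -/
theorem genN_exp_le {m : ℕ} (n : ℕ) (hn : 1 ≤ n)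
    (lam μ γ : Fin m → ℝ) (hlam : ∀ i, 0 < lam i) (hμ : ∀ i, 0 < μ i)
    (hγ : ∀ i, 0 ≤ γ i) (hρ : 0 < rhoN n lam μ) {ε θ L : ℝ} (hε : 0 < ε) (hθ : 0 ≤ θ)
    (hL : L = ∑ j, lam j / μ j + rhoN n lam μ) (hεL : ε * L ≤ 1) (hη : 3 * (ε * L)^2 + θ ≤ 1)
    (hεμ : ∀ i, ε ≤ μ i) (x z : Fin m → ℕ) (hzx : ∀ i, z i ≤ x i) (hz : ∑ i, z i = n) :
    genN lam μ γ z (fun y => Real.exp (∑ i, coordExp ε θ (hatX n lam μ y i) / μ i)) x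
      ≤ (ε * (-rhoN n lam μ + Real.sqrt n * (3 * (ε * L)^2 + θ)
            + ε * ∑ i, (lam i / μ i ^ 2 + n / μ i)))
          * Real.exp (∑ i, coordExp ε θ (hatX n lam μ x i) / μ i) := by
  set V := Real.exp (∑ i, coordExp ε θ (hatX n lam μ x i) / μ i) with hV
  set a := 1 / Real.sqrt n with ha
  set η := 3 * (ε * L)^2 + θ with hηd
  have hs : 1 ≤ Real.sqrt n := Real.one_le_sqrt.2 (by exact_mod_cast hn)
  have ha0 : 0 < a := by positivity
  have ha1 : a ≤ 1 := (div_le_one (by linarith)).2 hs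
  have hη0 : 0 ≤ η := by positivity
  have hL0 : 0 ≤ L := by
    rw [hL]
    exact add_nonneg (Finset.sum_nonneg fun j _ => (div_pos (hlam j) (hμ j)).le) hρ.le
  have hV0 : 0 < V := Real.exp_pos _
  have hb0 : ∀ i, 0 ≤ ε * a / μ i := fun i => by have := hμ i; positivity
  have hb1 : ∀ i, ε * a / μ i ≤ 1 := fun i =>
    (div_le_one (hμ i)).2 ((mul_le_of_le_one_right hε.le ha1).trans (hεμ i))
  have hbε : ∀ i, (ε * a / μ i)^2 ≤ ε^2 / μ i ^ 2 := fun i => by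
    rw [div_pow]
    have h := mul_le_of_le_one_right hε.le ha1
    gcongr
  have hzn : ∀ i, (z i : ℝ) ≤ n := fun i => by
    have h := Finset.single_le_sum (f := z) (fun _ _ => Nat.zero_le _) (Finset.mem_univ i)
    exact_mod_cast hz ▸ h
  have hup : ∀ i, lam i * (Real.exp (∑ j, coordExp ε θ
      (hatX n lam μ (x + Pi.single i 1) j) / μ j) - V)
        ≤ (ε * a * (lam i / μ i) + ε^2 * (lam i / μ i ^ 2)) * V := by
    intro i
    rw [hatX_add_single, sum_update_eq (fun j t => coordExp ε θ t / μ j), Real.exp_add, ← hV,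
      ← sub_div]
    have h₁ : (coordExp ε θ (hatX n lam μ x i + a) - coordExp ε θ (hatX n lam μ x i)) / μ i
        ≤ ε * a / μ i :=
      div_le_div_of_nonneg_right (coordExp_add_sub_le hε.le hθ ha0.le _) (hμ i).le
    have h₂ := exp_sub_one_le (abs_le.2 ⟨by linarith [hb0 i], hb1 i⟩ : |ε * a / μ i| ≤ 1)
    have h₃ := Real.exp_le_exp.2 h₁
    have h₄ := mul_le_mul_of_nonneg_left
      (by linarith [hbε i] : Real.exp ((coordExp ε θ (hatX n lam μ x i + a)
        - coordExp ε θ (hatX n lam μ x i)) / μ i) - 1 ≤ ε * a / μ i + ε^2 / μ i ^ 2)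
      (mul_pos (hlam i) hV0).le
    calc _ = lam i * V * (Real.exp ((coordExp ε θ (hatX n lam μ x i + a)
        - coordExp ε θ (hatX n lam μ x i)) / μ i) - 1) := by ring
      _ ≤ _ := h₄
      _ = _ := by ring
  have hdown : ∀ i, (μ i * (z i : ℝ) + γ i * ((x i : ℝ) - (z i : ℝ))) * (Real.exp (∑ j,
      coordExp ε θ (hatX n lam μ (x - Pi.single i 1) j) / μ j) - V)
        ≤ (ε^2 * (n / μ i) - ε * a * (1 - η) * z i) * V := by
    intro i
    have hμi := hμ i
    rcases Nat.eq_zero_or_pos (x i) with hxi | hxi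
    · have hzi : z i = 0 := Nat.le_zero.1 (hxi ▸ hzx i)
      simp only [hxi, hzi, Nat.cast_zero, mul_zero, sub_zero, add_zero, zero_mul]
      positivity
    have ht := neg_le_hatX n hn lam μ hlam hμ hρ (x - Pi.single i 1) i
    rw [hatX_sub_single n lam μ x i hxi] at ht ⊢
    rw [Function.update_self, ← hL] at ht
    rw [sum_update_eq (fun j t => coordExp ε θ t / μ j), Real.exp_add, ← hV, ← sub_div]
    have h₁ := le_coordExp_sub hε.le hθ ha0.le hL0 hεL ht
    set u := ε * a / μ i * (1 - η) with hu
    have hu0 : 0 ≤ u := mul_nonneg (hb0 i) (by linarith)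
    have hub : u ≤ ε * a / μ i := mul_le_of_le_one_right (hb0 i) (by linarith)
    have h₂ : (coordExp ε θ (hatX n lam μ x i - a) - coordExp ε θ (hatX n lam μ x i)) / μ i
        ≤ -u := by
      rw [div_le_iff₀ hμi, hu]
      have : -(ε * a / μ i * (1 - η)) * μ i = -(ε * a * (1 - η)) := by field_simp
      linarith
    have h₃ := exp_sub_one_le
      (abs_le.2 ⟨by linarith [hb1 i], by linarith⟩ : |-u| ≤ 1)
    have h₄ := Real.exp_le_exp.2 h₂
    set w := Real.exp ((coordExp ε θ (hatX n lam μ x i - a)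
      - coordExp ε θ (hatX n lam μ x i)) / μ i) with hw
    have hw1 : w ≤ 1 := Real.exp_le_one_iff.2 (h₂.trans (by linarith))
    have hu2 : u^2 ≤ ε^2 / μ i ^ 2 := (pow_le_pow_left₀ hu0 hub 2).trans (hbε i)
    have hxz : (0:ℝ) ≤ (x i : ℝ) - z i := sub_nonneg.2 (by exact_mod_cast hzx i)
    have h₅ : γ i * ((x i : ℝ) - z i) * (w - 1) ≤ 0 :=
      mul_nonpos_of_nonneg_of_nonpos (mul_nonneg (hγ i) hxz) (by linarith)
    have h₆ : μ i * z i * (w - 1) ≤ μ i * z i * (-u + ε^2 / μ i ^ 2) :=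
      mul_le_mul_of_nonneg_left (by linarith [neg_sq u]) (by positivity)
    have h₇ : μ i * z i * (-u + ε^2 / μ i ^ 2) = ε^2 * (z i / μ i) - ε * a * (1 - η) * z i := by
      rw [hu]
      field_simp
      ring
    have h₈ : ε^2 * (z i / μ i) ≤ ε^2 * (n / μ i) := by
      have := hzn i
      gcongr
    calc _ = (μ i * z i * (w - 1) + γ i * ((x i : ℝ) - z i) * (w - 1)) * V := by ring
      _ ≤ _ := mul_le_mul_of_nonneg_right (by linarith) hV0.le
  have hzsum : ∑ i, (z i : ℝ) = n := by exact_mod_cast hz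
  have hrate := sum_rates_sub n hn lam μ
  have han : a * n = Real.sqrt n := by
    rw [ha, one_div_mul_eq_div, Real.div_sqrt]
  calc genN lam μ γ z (fun y => Real.exp (∑ i, coordExp ε θ (hatX n lam μ y i) / μ i)) x
      ≤ ∑ i, (ε * a * (lam i / μ i) + ε^2 * (lam i / μ i ^ 2)) * V
        + ∑ i, (ε^2 * (n / μ i) - ε * a * (1 - η) * z i) * V :=
        add_le_add (Finset.sum_le_sum fun i _ => hup i) (Finset.sum_le_sum fun i _ => hdown i)
    _ = (ε * (a * (∑ i, lam i / μ i - n) + a * n * η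
          + ε * ∑ i, (lam i / μ i ^ 2 + n / μ i))) * V := by
        rw [← Finset.sum_mul, ← Finset.sum_mul, Finset.sum_add_distrib, Finset.sum_sub_distrib,
          Finset.sum_add_distrib, ← Finset.mul_sum, ← Finset.mul_sum, ← Finset.mul_sum,
          ← Finset.mul_sum, hzsum]
        ring
    _ = _ := by rw [hrate, han]

/-- Any function of state and allocation is bounded above on the states with idle servers. -/
theorem exists_bound_of_sum_le {m : ℕ} (n : ℕ) (G : (Fin m → ℕ) → (Fin m → ℕ) → ℝ) :
    ∃ C > (0:ℝ), ∀ x z : Fin m → ℕ, ∑ i, x i ≤ n → (∀ i, z i ≤ x i) → G x z ≤ C := by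
  have hfin : (Set.Iic (fun _ : Fin m => n) ×ˢ Set.Iic (fun _ : Fin m => n)).Finite :=
    (Set.finite_Iic _).prod (Set.finite_Iic _)
  obtain ⟨C, hC⟩ := (hfin.image fun p => G p.1 p.2).bddAbove
  refine ⟨max C 1, by positivity, fun x z hx hz => le_max_of_le_left (hC ⟨(x, z), ?_, rfl⟩)⟩
  have hxn : ∀ i, x i ≤ n := fun i =>
    (Finset.single_le_sum (fun _ _ => Nat.zero_le _) (Finset.mem_univ i)).trans hx
  exact ⟨hxn, fun i => (hz i).trans (hxn i)⟩

/-- Corollary 3.1: if ρⁿ > 0, there are θ ∈ (0,1] and ε̂₀ > 0 so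
that for every ε ∈ (0, ε̂₀) there is C₀ > 0 with
𝒜ⁿ_z V̂(x) ≤ C₀ − ε(ρⁿ/(2m))V̂(x) for all x ∈ ℤ₊^m and z ∈ 𝒵ⁿ(x), where
V̂(x) = exp(εθΨⁿ(−x̂ⁿ(x)) + Ψⁿ_ε(x̂ⁿ(x))). -/
theorem stmt15 {m : ℕ} (hm : 1 ≤ m) (n : ℕ) (hn : 1 ≤ n)
    (lam μ γ : Fin m → ℝ) (hlam : ∀ i, 0 < lam i) (hμ : ∀ i, 0 < μ i)
    (hγ : ∀ i, 0 ≤ γ i) (hρ : 0 < rhoN n lam μ) :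
    ∃ θ ∈ Set.Ioc (0:ℝ) 1, ∃ ε₀ > (0:ℝ), ∀ ε : ℝ, 0 < ε → ε < ε₀ →
      ∃ C₀ > (0:ℝ), ∀ x : Fin m → ℕ, ∀ z ∈ workCons n x,
        genN lam μ γ z
            (fun y => Real.exp (ε * θ * bigPsi μ (-(hatX n lam μ y))
              + bigPsiE μ ε (hatX n lam μ y))) x
          ≤ C₀ - ε * (rhoN n lam μ / (2 * m))
              * Real.exp (ε * θ * bigPsi μ (-(hatX n lam μ x))
                  + bigPsiE μ ε (hatX n lam μ x)) := by
  simp only [exponent_eq_sum]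
  set ρ := rhoN n lam μ with hρd
  set L := ∑ j, lam j / μ j + ρ with hL
  set s := Real.sqrt n with hsd
  set K := ∑ i, (lam i / μ i ^ 2 + n / μ i) with hK
  have hs : 1 ≤ s := Real.one_le_sqrt.2 (by exact_mod_cast hn)
  have hL0 : 0 ≤ L :=
    add_nonneg (Finset.sum_nonneg fun j _ => (div_pos (hlam j) (hμ j)).le) hρ.le
  have hK0 : 0 ≤ K := Finset.sum_nonneg fun i _ => by
    have := hμ i
    have := hlam i
    positivity
  have hN0 : 0 ≤ ∑ i, 1 / μ i := Finset.sum_nonneg fun i _ => by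
    have := hμ i
    positivity
  set N := ∑ i, 1 / μ i with hN
  set θ := min (1/2) (ρ / (8 * s)) with hθd
  have hθ0 : 0 < θ := by positivity
  have hθ1 : θ ≤ 1/2 := min_le_left _ _
  have hsθ : s * θ ≤ ρ / 8 := by
    calc s * θ ≤ s * (ρ / (8 * s)) := by gcongr; exact min_le_right _ _
      _ = ρ / 8 := by field_simp
  set D := 1 + L + 6 * L^2 + N + 4 * (3 * s * L^2 + K) / ρ with hD
  have hR0 : 0 ≤ 4 * (3 * s * L^2 + K) / ρ := by positivity
  have hD0 : 0 < D := by positivity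
  refine ⟨θ, ⟨hθ0, by linarith⟩, 1 / D, by positivity, fun ε hε hεD => ?_⟩
  have hεD' : ε * D ≤ 1 := ((lt_div_iff₀ hD0).1 hεD).le
  have key : ∀ A, A ≤ D → ε * A ≤ 1 := fun A hA =>
    (mul_le_mul_of_nonneg_left hA hε.le).trans hεD'
  have hL2 := sq_nonneg L
  have hε1 : ε ≤ 1 := by simpa using key 1 (by linarith)
  have hεL : ε * L ≤ 1 := key L (by linarith)
  have hεL2 : ε * (6 * L^2) ≤ 1 := key _ (by linarith)
  have hεN : ε * N ≤ 1 := key N (by linarith)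
  have hεR : ε * (3 * s * L^2 + K) ≤ ρ / 4 := by
    have h := mul_le_mul_of_nonneg_right (key (4 * (3 * s * L^2 + K) / ρ) (by linarith)) hρ.le
    have h' : ε * (4 * (3 * s * L^2 + K) / ρ) * ρ = 4 * (ε * (3 * s * L^2 + K)) := by
      field_simp
    linarith
  have hsq : (ε * L)^2 ≤ ε * L^2 := by
    rw [mul_pow, sq ε]
    exact mul_le_mul_of_nonneg_right (mul_le_of_le_one_right hε.le hε1) hL2
  have hεμ : ∀ i, ε ≤ μ i := fun i => by
    have h : 1 / μ i ≤ N := Finset.single_le_sum (f := fun j => 1 / μ j)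
      (fun j _ => (one_div_pos.2 (hμ j)).le) (Finset.mem_univ i)
    have h' := (mul_le_mul_of_nonneg_left h hε.le).trans hεN
    rwa [mul_one_div, div_le_one (hμ i)] at h'
  have hm' : (1:ℝ) ≤ m := by exact_mod_cast hm
  have hρm : ρ / (2 * m) ≤ ρ / 2 := by gcongr; linarith
  obtain ⟨C₀, hC₀, hC⟩ := exists_bound_of_sum_le n fun x z =>
    genN lam μ γ z (fun y => Real.exp (∑ i, coordExp ε θ (hatX n lam μ y i) / μ i)) x
      + ε * (ρ / (2 * m)) * Real.exp (∑ i, coordExp ε θ (hatX n lam μ x i) / μ i)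
  refine ⟨C₀, hC₀, fun x z ⟨hzx, hz⟩ => ?_⟩
  rcases le_total (∑ i, x i) n with hx | hx
  · linarith [hC x z hx hzx]
  have hdrift := genN_exp_le n hn lam μ γ hlam hμ hγ hρ hε hθ0.le hL hεL (by linarith) hεμ x z hzx
    (hz.trans (min_eq_left hx))
  have hcoef : -ρ + s * (3 * (ε * L)^2 + θ) + ε * K ≤ -(ρ / (2 * m)) := by
    have h := mul_le_mul_of_nonneg_left hsq (by positivity : 0 ≤ 3 * s)
    linarith
  have h := mul_le_mul_of_nonneg_right (mul_le_mul_of_nonneg_left hcoef hε.le)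
    (Real.exp_pos (∑ i, coordExp ε θ (hatX n lam μ x i) / μ i)).le
  linarith
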